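/- The function u(τ) = (2πi/3)·ℰ₃(τ), where ℰ₃ := (𝒞₃³)′/𝒞₃³ with 𝒞₃(τ) = 3·η(3τ)³/η(τ), satisfies the generalized Chazy equation u₄u₈² − u₆²u₈ + 24u₄³u₈ − 15u₄²u₆² + 144u₄⁵ = 0 on the upper half-plane. -/

import Mathlib

open Complex

noncomputable section

/-- q = exp(2πiτ). -/
def qq (τ : ℂ) : ℂ := Complex.exp (2 * Real.pi * Complex.I * τ)

/-- The Dedekind eta function η(τ) = exp(πiτ/12)·∏_{n≥1} (1 − qⁿ). -/
def dedekindEta (τ : ℂ) : ℂ :=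
  Complex.exp (Real.pi * Complex.I * τ / 12) * ∏' n : ℕ, (1 - qq τ ^ (n + 1))

/-- 𝒞₃(τ) = 3·η(3τ)³/η(τ). -/
def C3 (τ : ℂ) : ℂ := 3 * dedekindEta (3 * τ) ^ 3 / dedekindEta τ

/-- The derivation f ↦ f′ = (2πi)⁻¹ df/dτ = q d/dq. -/
def dq (f : ℂ → ℂ) : ℂ → ℂ := fun τ => (2 * Real.pi * Complex.I)⁻¹ * deriv f τ

/-- ℰ₃ := (𝒞₃³)′/𝒞₃³. -/
def E3sig : ℂ → ℂ := fun τ => dq (fun t => C3 t ^ 3) τ / C3 τ ^ 3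

/-- u₄ = u̇ − u². -/
def chazyU4 (u : ℂ → ℂ) (τ : ℂ) : ℂ := deriv u τ - u τ ^ 2

/-- u₆ = ü − 6uu̇ + 4u³. -/
def chazyU6 (u : ℂ → ℂ) (τ : ℂ) : ℂ :=
  deriv (deriv u) τ - 6 * u τ * deriv u τ + 4 * u τ ^ 3

/-- u₈ = u⃛ − 12uü − 6u̇² + 48u²u̇ − 24u⁴. -/
def chazyU8 (u : ℂ → ℂ) (τ : ℂ) : ℂ :=
  deriv (deriv (deriv u)) τ - 12 * u τ * deriv (deriv u) τ - 6 * (deriv u τ) ^ 2 +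
    48 * u τ ^ 2 * deriv u τ - 24 * u τ ^ 4


namespace Ch

open UpperHalfPlane hiding I
open Filter Topology Manifold ModularForm MatrixGroups EisensteinSeries ModularGroup

lemma zpow_aux (a b z : ℂ) (hz : z ≠ 0) (n : ℕ) (h : a * z ^ (-(n : ℤ)) = b) : a = z ^ n * b := by
  rw [← h, zpow_neg, zpow_natCast]
  field_simp

lemma zpow_aux2 (a b z : ℂ) (hz : z ≠ 0) (n m : ℕ) :
    (z ^ n * a / (z ^ 12 * b) ^ m) * z ^ (-((n : ℤ) - 12 * m)) = a / b ^ m := by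
  rw [neg_sub, zpow_sub₀ hz, zpow_mul, zpow_natCast, zpow_natCast, mul_pow]
  have h : (z ^ (12 : ℤ)) = z ^ 12 := by norm_cast
  rw [h]
  field_simp

lemma denom_T (z : ℍ) : denom (T : GL (Fin 2) ℝ) z = 1 := by
  rw [ModularGroup.denom_apply]
  simp [ModularGroup.T]

/-- Level-one vanishing criterion. -/
lemma lvl1 (f : ℂ → ℂ) (n m : ℕ) (hnm : n < 12 * m)
    (hd : ∀ z : ℂ, 0 < z.im → DifferentiableAt ℂ f z)
    (hT : ∀ z : ℂ, 0 < z.im → f (z + 1) = f z)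
    (hS : ∀ z : ℂ, 0 < z.im → f (-1 / z) = z ^ n * f z)
    (hb : ∃ C A : ℝ, ∀ z : ℂ, A ≤ z.im → 0 < z.im →
      ‖f z‖ ≤ C * Real.exp (-2 * Real.pi * z.im) ^ m) :
    ∀ z : ℂ, 0 < z.im → f z = 0 := by
  let g : ℍ → ℂ := fun z => f z / discriminant z ^ m
  have hgS : g ∣[(n : ℤ) - 12 * m] S = g := by
    ext z
    have hz : (z : ℂ) ≠ 0 := ne_zero z
    have h1 := congrFun discriminant_S_invariant z
    rw [SlashInvariantForm.slash_S_apply] at h1 ⊢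
    have h2 := hS z z.2
    have h3 : ((UpperHalfPlane.mk _ z.im_inv_neg_coe_pos : ℍ) : ℂ) = -1 / z := by
      simp [neg_div, inv_neg]
    have hD := discriminant_ne_zero z
    have h4 : discriminant (UpperHalfPlane.mk _ z.im_inv_neg_coe_pos) = z ^ 12 * discriminant z :=
      zpow_aux _ _ _ hz 12 h1
    simp only [g]
    rw [h4, show (-(z:ℂ))⁻¹ = -1 / z by simp [neg_div, inv_neg], h2, zpow_aux2 _ _ _ hz]
  have hgT : g ∣[(n : ℤ) - 12 * m] T = g := by
    ext z
    have h1 := congrFun discriminant_T_invariant z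
    rw [SL_slash_apply, modular_T_smul] at h1 ⊢
    have h2 := hT z z.2
    have h3 : (((1 : ℝ) +ᵥ z : ℍ) : ℂ) = z + 1 := by
      simp [add_comm]
    have hden : denom (T : GL (Fin 2) ℝ) z = 1 := denom_T _
    rw [hden] at h1 ⊢
    simp only [one_zpow, mul_one] at h1 ⊢
    simp only [g]
    rw [h3, h2, h1]
  have hg := SlashInvariantForm.slash_action_generators_SL2Z hgS hgT
  have hgd : MDiff g := by
    have h1 : MDiff (fun z : ℍ => f z) := by
      rw [UpperHalfPlane.mdifferentiable_iff]
      refine DifferentiableOn.congr (f := f) (fun z hz => (hd z hz).differentiableWithinAt) ?_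
      intro z hz
      simp [ofComplex_apply_of_im_pos hz]
    have h2 : MDiff (discriminant : ℍ → ℂ) := CuspForm.discriminant.holo'
    exact h1.div (h2.pow m) (fun z => pow_ne_zero _ (discriminant_ne_zero z))
  have hgb : IsBoundedAtImInfty g := by
    have h1 : (fun z : ℍ => f z) =O[atImInfty] (fun z : ℍ => Real.exp (-2 * Real.pi * z.im) ^ m) := by
      obtain ⟨C, A, h⟩ := hb
      refine Asymptotics.IsBigO.of_bound C ?_
      rw [Filter.Eventually, atImInfty_mem]
      refine ⟨A, fun z hz => ?_⟩
      have := h z hz z.2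
      simp only [Set.mem_ofPred_eq]
      refine this.trans (le_of_eq ?_)
      rw [Real.norm_of_nonneg (by positivity)]
      rfl
    have h2 := (exp_isBigO_discriminant).pow m
    have h3 := h1.trans h2
    have h4 := h3.mul (Asymptotics.isBigO_refl (fun z : ℍ => (discriminant z ^ m)⁻¹) atImInfty)
    have h5 : g =O[atImInfty] (1 : ℍ → ℂ) := by
      refine (h4.congr_right (g₂ := 1) fun z => ?_).congr_left fun z => ?_
      · simp [mul_inv_cancel₀ (pow_ne_zero m (discriminant_ne_zero z))]
      · simp [g, div_eq_mul_inv]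
    exact h5.trans (Asymptotics.isBigO_of_le _ (fun _ => by simp))
  let G : ModularForm 𝒮ℒ ((n : ℤ) - 12 * m) :=
    { toFun := g
      slash_action_eq' := fun _ ⟨γ, hγ⟩ ↦ hγ ▸ hg γ
      holo' := hgd
      bdd_at_cusps' := by
        intro c hc
        rw [Subgroup.IsArithmetic.isCusp_iff_isCusp_SL2Z] at hc
        rw [OnePoint.isBoundedAt_iff_forall_SL2Z hc]
        intro γ _
        rw [hg γ]
        exact hgb }
  have hG : (G : ℍ → ℂ) = 0 := ModularFormClass.levelOne_neg_weight_eq_zero (by omega) G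
  intro z hz
  have h5 : g ⟨z, hz⟩ = 0 := congrFun hG ⟨z, hz⟩
  simp only [g, div_eq_zero_iff] at h5
  rcases h5 with h5 | h5
  · exact h5
  · exact absurd h5 (pow_ne_zero _ (discriminant_ne_zero _))

/-- The Eisenstein series `E₂` as a function on the complex plane. -/
def P (z : ℂ) : ℂ := E2 (ofComplex z)

lemma P_eq (z : ℍ) : P z = E2 z := by simp [P]

lemma P_diff {z : ℂ} (hz : 0 < z.im) : DifferentiableAt ℂ P z := by
  have := E2_mdifferentiable
  rw [UpperHalfPlane.mdifferentiable_iff] at this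
  exact (this z hz).differentiableAt (isOpen_upperHalfPlaneSet.mem_nhds hz)

lemma k_ne : (2 * Real.pi * I : ℂ) ≠ 0 := by
  simp [Real.pi_ne_zero]

lemma P_S {z : ℂ} (hz : 0 < z.im) :
    P (-1 / z) = z ^ 2 * P z + 12 / (2 * Real.pi * I) * z := by
  have h := congrFun (E2_slash_action S) ⟨z, hz⟩
  have hz0 : z ≠ 0 := by rintro rfl; simp at hz
  rw [SlashInvariantForm.slash_S_apply] at h
  simp only [Pi.sub_apply, Pi.smul_apply, D2_S, smul_eq_mul, riemannZeta_two, ← P_eq] at h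
  have hpi : (Real.pi : ℂ) ≠ 0 := by simp [Real.pi_ne_zero]
  have h4 : P (-1 / z) = z ^ 2 * (P (-1 / z) * z ^ (-(2:ℤ))) := by
    rw [zpow_neg]; norm_cast; field_simp
  rw [h4]
  rw [show (-z)⁻¹ = -1 / z by simp [neg_div, inv_neg]] at h
  rw [h]
  field_simp
  have : (I:ℂ)^2 = -1 := I_sq
  linear_combination (-12 : ℂ) * this

def QE (f φ : ℂ → ℂ) : Prop :=
  DifferentiableOn ℂ φ (Metric.ball 0 1) ∧ ∀ z : ℂ, 0 < z.im → f z = φ (qq z)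

lemma qq_mem {z : ℂ} (hz : 0 < z.im) : qq z ∈ Metric.ball (0:ℂ) 1 := by
  have := norm_exp_two_pi_I_lt_one ⟨z, hz⟩
  simpa [qq] using this

lemma P_QE : ∃ φ, QE P φ ∧ φ 0 = 1 := by
  have hper : Function.Periodic (E2 ∘ ofComplex) ((1 : ℝ) : ℂ) := by
    intro z
    by_cases hz : 0 < z.im
    · have h := congrFun (E2_slash_action T) ⟨z, hz⟩
      rw [SL_slash_apply, modular_T_smul] at h
      have hden : denom (T : GL (Fin 2) ℝ) (⟨z, hz⟩ : ℍ) = 1 := denom_T _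
      rw [hden] at h
      simp only [Pi.sub_apply, D2_T, one_zpow, mul_one, Pi.zero_apply, smul_zero,
        sub_zero] at h
      have hz1 : 0 < (z + (1 : ℝ)).im := by simpa using hz
      simp only [Function.comp_apply]
      rw [ofComplex_apply_of_im_pos hz, ofComplex_apply_of_im_pos hz1, ← h]
      congr 1
      ext
      simp [add_comm]
    · have hz1 : (z + (1 : ℝ)).im ≤ 0 := by simpa using hz
      simp only [Function.comp_apply]
      rw [ofComplex_apply_of_im_nonpos (not_lt.mp hz), ofComplex_apply_of_im_nonpos hz1]
  refine ⟨cuspFunction 1 E2, ⟨?_, ?_⟩, ?_⟩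
  · exact differentiableOn_cuspFunction_ball one_pos hper E2_mdifferentiable isBoundedAtImInfty_E2
  · intro z hz
    have := eq_cuspFunction ⟨z, hz⟩ one_ne_zero hper
    rw [← P_eq] at this
    simpa [Function.Periodic.qParam, qq] using this.symm
  · have ha := analyticAt_cuspFunction_zero one_pos hper E2_mdifferentiable isBoundedAtImInfty_E2
    have := hasFPowerSeriesOnBall_cuspFunction one_pos ha (fun τ => by
      simpa only [Function.Periodic.qParam, ofReal_one, div_one] using hasSum_qExpansion_E2 (z := τ))
    have h0 := this.coeff_zero (fun _ => 0)
    simpa using h0.symm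

end Ch

namespace Ch

open Filter Topology

def kk : ℂ := 2 * Real.pi * I

lemma kk_ne : kk ≠ 0 := k_ne

lemma QE.congr {f g φ : ℂ → ℂ} (hf : QE f φ) (h : ∀ z, 0 < z.im → g z = f z) : QE g φ :=
  ⟨hf.1, fun z hz => by rw [h z hz, hf.2 z hz]⟩

lemma QE.add {f g φ ψ : ℂ → ℂ} (hf : QE f φ) (hg : QE g ψ) :
    QE (fun z => f z + g z) (fun q => φ q + ψ q) :=
  ⟨hf.1.add hg.1, fun z hz => by dsimp only; rw [hf.2 z hz, hg.2 z hz]⟩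

lemma QE.sub {f g φ ψ : ℂ → ℂ} (hf : QE f φ) (hg : QE g ψ) :
    QE (fun z => f z - g z) (fun q => φ q - ψ q) :=
  ⟨hf.1.sub hg.1, fun z hz => by dsimp only; rw [hf.2 z hz, hg.2 z hz]⟩

lemma QE.mul {f g φ ψ : ℂ → ℂ} (hf : QE f φ) (hg : QE g ψ) :
    QE (fun z => f z * g z) (fun q => φ q * ψ q) :=
  ⟨hf.1.mul hg.1, fun z hz => by dsimp only; rw [hf.2 z hz, hg.2 z hz]⟩

lemma QE.cmul {f φ : ℂ → ℂ} (c : ℂ) (hf : QE f φ) :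
    QE (fun z => c * f z) (fun q => c * φ q) :=
  ⟨hf.1.const_mul c, fun z hz => by dsimp only; rw [hf.2 z hz]⟩

lemma qq_hasDerivAt (z : ℂ) : HasDerivAt qq (kk * qq z) z := by
  have := ((hasDerivAt_id z).const_mul kk).cexp
  simp only [id, mul_one] at this
  rw [mul_comm]
  exact this

lemma im_pos_nhds {z : ℂ} (hz : 0 < z.im) : ∀ᶠ w in 𝓝 z, 0 < w.im :=
  (isOpen_lt continuous_const continuous_im).mem_nhds hz

lemma QE.hasDerivAt {f φ : ℂ → ℂ} (hf : QE f φ) {z : ℂ} (hz : 0 < z.im) :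
    HasDerivAt f (deriv φ (qq z) * (kk * qq z)) z := by
  have h1 : DifferentiableAt ℂ φ (qq z) :=
    hf.1.differentiableAt (Metric.isOpen_ball.mem_nhds (qq_mem hz))
  have h2 := h1.hasDerivAt.comp z (qq_hasDerivAt z)
  refine h2.congr_of_eventuallyEq ?_
  filter_upwards [im_pos_nhds hz] with w hw
  exact hf.2 w hw

lemma QE.diff {f φ : ℂ → ℂ} (hf : QE f φ) {z : ℂ} (hz : 0 < z.im) : DifferentiableAt ℂ f z :=
  (hf.hasDerivAt hz).differentiableAt

lemma QE.D {f φ : ℂ → ℂ} (hf : QE f φ) :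
    QE (fun z => deriv f z / kk) (fun q => q * deriv φ q) := by
  refine ⟨differentiableOn_id.mul (hf.1.deriv Metric.isOpen_ball), fun z hz => ?_⟩
  dsimp only
  rw [(hf.hasDerivAt hz).deriv]
  have := kk_ne
  field_simp

lemma QE.comp3 {f φ : ℂ → ℂ} (hf : QE f φ) :
    QE (fun z => f (3 * z)) (fun q => φ (q ^ 3)) := by
  refine ⟨hf.1.comp (differentiableOn_id.pow 3) ?_, fun z hz => ?_⟩
  · intro q hq
    simp only [Metric.mem_ball, dist_zero_right] at hq ⊢
    simp only [norm_pow]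
    exact pow_lt_one₀ (norm_nonneg _) hq (by norm_num)
  · dsimp only
    rw [hf.2 _ (by simpa using hz)]
    congr 1
    rw [qq, qq, ← Complex.exp_nat_mul]
    congr 1
    push_cast
    ring

lemma qq_per (z : ℂ) : qq (z + 1) = qq z := by
  rw [qq, qq, mul_add, mul_one, Complex.exp_periodic]

lemma QE.per {f φ : ℂ → ℂ} (hf : QE f φ) {z : ℂ} (hz : 0 < z.im) : f (z + 1) = f z := by
  rw [hf.2 z hz, hf.2 _ (by simpa using hz), qq_per]

lemma qq_norm (z : ℂ) : ‖qq z‖ = Real.exp (-2 * Real.pi * z.im) := by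
  rw [qq, Complex.norm_exp]
  simp

lemma exists_A {ε : ℝ} (hε : 0 < ε) :
    ∃ A : ℝ, ∀ z : ℂ, A ≤ z.im → ‖qq z‖ < ε := by
  refine ⟨(1 - Real.log ε) / (2 * Real.pi), fun z hz => ?_⟩
  rw [qq_norm, ← Real.lt_log_iff_exp_lt hε]
  rw [div_le_iff₀ (by positivity)] at hz
  linarith

lemma QE.bound {f φ : ℂ → ℂ} (hf : QE f φ) (h0 : φ 0 = 0) :
    ∃ C A : ℝ, 0 ≤ C ∧ ∀ z : ℂ, A ≤ z.im → 0 < z.im →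
      ‖f z‖ ≤ C * Real.exp (-2 * Real.pi * z.im) := by
  have h1 : DifferentiableAt ℂ φ 0 :=
    hf.1.differentiableAt (Metric.isOpen_ball.mem_nhds (by simp))
  obtain ⟨C, hC, hC'⟩ := h1.isBigO_sub.exists_nonneg
  obtain ⟨ε, hε, h⟩ := Metric.eventually_nhds_iff_ball.mp hC'.bound
  obtain ⟨A, hA⟩ := exists_A hε
  refine ⟨C, A, hC, fun z hz hz' => ?_⟩
  have := h (qq z) (by simpa using hA z hz)
  simp only [h0, sub_zero] at this
  rw [hf.2 z hz', ← qq_norm]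
  exact this

lemma QE.tendsto {f φ : ℂ → ℂ} (hf : QE f φ) (h0 : φ 0 ≠ 0) :
    ∃ z : ℂ, 0 < z.im ∧ f z ≠ 0 := by
  have h1 : ContinuousAt φ 0 :=
    (hf.1.differentiableAt (Metric.isOpen_ball.mem_nhds (by simp))).continuousAt
  obtain ⟨ε, hε, h⟩ := Metric.eventually_nhds_iff_ball.mp (h1.eventually_ne h0)
  obtain ⟨A, hA⟩ := exists_A hε
  have h2 : 0 < (((max A 1 : ℝ) : ℂ) * I).im := by simp
  refine ⟨((max A 1 : ℝ) : ℂ) * I, h2, ?_⟩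
  rw [hf.2 _ h2]
  refine h _ ?_
  have := hA (((max A 1 : ℝ) : ℂ) * I) (by simp)
  simpa using this

lemma dS {f g : ℂ → ℂ} {g' z : ℂ} (hz : 0 < z.im) (hfd : DifferentiableAt ℂ f (-1 / z))
    (h : ∀ z, 0 < z.im → f (-1 / z) = g z) (hg : HasDerivAt g g' z) :
    deriv f (-1 / z) = z ^ 2 * g' := by
  have hz0 : z ≠ 0 := by rintro rfl; simp at hz
  have h1 : HasDerivAt (fun z : ℂ => -1 / z) (1 / z ^ 2) z := by
    have := (hasDerivAt_inv hz0).const_mul (-1)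
    refine (this.congr_deriv ?_).congr_of_eventuallyEq ?_
    · field_simp
    · exact Eventually.of_forall fun w => by simp [div_eq_mul_inv]
  have h2 := hfd.hasDerivAt.comp z h1
  have h3 : HasDerivAt (f ∘ fun z : ℂ => -1 / z) g' z := by
    refine hg.congr_of_eventuallyEq ?_
    filter_upwards [im_pos_nhds hz] with w hw
    exact h w hw
  have := h2.unique h3
  rw [← this]
  field_simp

def M (z : ℂ) : ℂ := P z * P z - 12 * (deriv P z / kk)
def U (z : ℂ) : ℂ := P z * M z - 3 * (deriv M z / kk)
def W (z : ℂ) : ℂ := P z * U z - 2 * (deriv U z / kk) - M z * M z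

lemma M_QE : ∃ φ, QE M φ ∧ φ 0 = 1 := by
  obtain ⟨φ, h, h0⟩ := P_QE
  exact ⟨_, (h.mul h).sub (h.D.cmul 12), by simp [h0]⟩

lemma U_QE : ∃ φ, QE U φ ∧ φ 0 = 1 := by
  obtain ⟨φ, h, h0⟩ := P_QE
  obtain ⟨ψ, g, g0⟩ := M_QE
  exact ⟨_, (h.mul g).sub (g.D.cmul 3), by simp [h0, g0]⟩

lemma W_QE : ∃ φ, QE W φ ∧ φ 0 = 0 := by
  obtain ⟨φ, h, h0⟩ := P_QE
  obtain ⟨ψ, g, g0⟩ := M_QE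
  obtain ⟨χ, f, f0⟩ := U_QE
  exact ⟨_, ((h.mul f).sub (f.D.cmul 2)).sub (g.mul g), by simp [h0, g0, f0]⟩

lemma M_diff {z : ℂ} (hz : 0 < z.im) : DifferentiableAt ℂ M z := by
  obtain ⟨φ, h, _⟩ := M_QE
  exact h.diff hz

lemma U_diff {z : ℂ} (hz : 0 < z.im) : DifferentiableAt ℂ U z := by
  obtain ⟨φ, h, _⟩ := U_QE
  exact h.diff hz

lemma S_im {z : ℂ} (hz : 0 < z.im) : 0 < (-1 / z).im := by
  have hz0 : z ≠ 0 := by rintro rfl; simp at hz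
  have : -1 / z = -z⁻¹ := by ring
  rw [this, neg_im, inv_im]
  have := normSq_pos.mpr hz0
  rw [neg_div, neg_neg]
  positivity

lemma M_S {z : ℂ} (hz : 0 < z.im) : M (-1 / z) = z ^ 4 * M z := by
  have h1 : HasDerivAt (fun z => z ^ 2 * P z + 12 / kk * z)
      (2 * z * P z + z ^ 2 * deriv P z + 12 / kk) z := by
    have := ((hasDerivAt_pow 2 z).mul (P_diff hz).hasDerivAt).add
      ((hasDerivAt_id z).const_mul (12 / kk))
    refine this.congr_deriv ?_
    simp
  have h2 := dS hz (P_diff (S_im hz)) (fun z hz => P_S hz) h1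
  have := kk_ne
  rw [M, M, h2, P_S hz, ← kk]
  field_simp
  ring

lemma U_S {z : ℂ} (hz : 0 < z.im) : U (-1 / z) = z ^ 6 * U z := by
  have h1 : HasDerivAt (fun z => z ^ 4 * M z)
      (4 * z ^ 3 * M z + z ^ 4 * deriv M z) z := by
    have := ((hasDerivAt_pow 4 z).mul (M_diff hz).hasDerivAt)
    refine this.congr_deriv ?_
    simp
  have h2 := dS hz (M_diff (S_im hz)) (fun z hz => M_S hz) h1
  have := kk_ne
  rw [U, U, h2, P_S hz, ← kk, M_S hz]
  field_simp
  ring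

lemma W_S {z : ℂ} (hz : 0 < z.im) : W (-1 / z) = z ^ 8 * W z := by
  have h1 : HasDerivAt (fun z => z ^ 6 * U z)
      (6 * z ^ 5 * U z + z ^ 6 * deriv U z) z := by
    have := ((hasDerivAt_pow 6 z).mul (U_diff hz).hasDerivAt)
    refine this.congr_deriv ?_
    simp
  have h2 := dS hz (U_diff (S_im hz)) (fun z hz => U_S hz) h1
  have := kk_ne
  rw [W, W, h2, P_S hz, ← kk, M_S hz, U_S hz]
  field_simp
  ring

lemma W_zero {z : ℂ} (hz : 0 < z.im) : W z = 0 := by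
  obtain ⟨φ, h, h0⟩ := W_QE
  refine lvl1 W 8 1 (by norm_num) (fun z hz => h.diff hz) (fun z hz => h.per hz)
    (fun z hz => W_S hz) ?_ z hz
  obtain ⟨C, A, _, hb⟩ := h.bound h0
  exact ⟨C, A, by simpa only [pow_one] using hb⟩

end Ch

namespace Ch

open Filter Topology

def R (z : ℂ) : ℂ := P (3 * z)
def N (z : ℂ) : ℂ := M (3 * z)
def V (z : ℂ) : ℂ := U (3 * z)
def Sg (z : ℂ) : ℂ := (1 / 2) * (3 * R z - P z)
def F (z : ℂ) : ℂ := 10 * (Sg z * Sg z) - M z - 9 * N z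

lemma Sg_QE : ∃ φ, QE Sg φ ∧ φ 0 = 1 := by
  obtain ⟨φ, h, h0⟩ := P_QE
  exact ⟨_, ((h.comp3.cmul 3).sub h).cmul (1 / 2), by norm_num [h0]⟩

lemma F_QE : ∃ φ, QE F φ ∧ φ 0 = 0 := by
  obtain ⟨φ, h, h0⟩ := Sg_QE
  obtain ⟨ψ, g, g0⟩ := M_QE
  exact ⟨_, (((h.mul h).cmul 10).sub g).sub (g.comp3.cmul 9), by norm_num [h0, g0]⟩

lemma im3 {z : ℂ} (hz : 0 < z.im) : 0 < (3 * z).im := by simpa using hz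

lemma F_fricke {z : ℂ} (hz : 0 < z.im) : F (-1 / (3 * z)) = 9 * z ^ 4 * F z := by
  have hz0 : z ≠ 0 := by rintro rfl; simp at hz
  have e : 3 * (-1 / (3 * z)) = -1 / z := by field_simp
  have hk := kk_ne
  simp only [F, Sg, R, N]
  rw [e, P_S hz, P_S (im3 hz), M_S hz, M_S (im3 hz), ← kk]
  field_simp
  ring

lemma F_per {z : ℂ} (hz : 0 < z.im) : F (z + 1) = F z := by
  obtain ⟨φ, h, h0⟩ := F_QE
  exact h.per hz

lemma F_trans {x y z : ℂ} (hx : 0 < x.im) (hy : 0 < y.im) (h4 : y ^ 4 = z ^ 4 * x ^ 4)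
    (h : F (-1 / (3 * x)) = F (-1 / (3 * y))) : F x = z ^ 4 * F y := by
  have hx0 : x ≠ 0 := by rintro rfl; simp at hx
  rw [F_fricke hx, F_fricke hy, h4] at h
  have : x ^ 4 ≠ 0 := pow_ne_zero _ hx0
  apply mul_left_cancel₀ this
  linear_combination h / 9

lemma im_div3 {z : ℂ} (hz : 0 < z.im) : 0 < (z / 3).im := by
  have : z / 3 = ((1 / 3 : ℝ) : ℂ) * z := by push_cast; ring
  rw [this, im_ofReal_mul]
  positivity

lemma im_div3_eq (z : ℂ) : (z / 3).im = z.im / 3 := by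
  have : z / 3 = ((1 / 3 : ℝ) : ℂ) * z := by push_cast; ring
  rw [this, im_ofReal_mul]
  ring

def G (z : ℂ) : ℂ := F z * (F (z / 3) * (F ((z + 1) / 3) * F ((z + 2) / 3)))

lemma F_diff {z : ℂ} (hz : 0 < z.im) : DifferentiableAt ℂ F z := by
  obtain ⟨φ, h, h0⟩ := F_QE
  exact h.diff hz

lemma F_diff3 (c : ℂ) (hc : c.im = 0) {z : ℂ} (hz : 0 < z.im) :
    DifferentiableAt ℂ (fun z => F ((z + c) / 3)) z := by
  have h : DifferentiableAt ℂ F ((z + c) / 3) := F_diff (im_div3 (by simpa [hc] using hz))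
  exact h.comp z (((differentiableAt_id).add_const c).div_const 3)

lemma G_diff {z : ℂ} (hz : 0 < z.im) : DifferentiableAt ℂ G z := by
  have h0 := F_diff3 0 (by simp) hz
  have h1 := F_diff3 1 (by simp) hz
  have h2 := F_diff3 2 (by simp) hz
  simp only [add_zero] at h0
  exact (F_diff hz).mul (h0.mul (h1.mul h2))

lemma G_per {z : ℂ} (hz : 0 < z.im) : G (z + 1) = G z := by
  simp only [G]
  rw [F_per hz, show (z + 1 + 1) / 3 = (z + 2) / 3 by ring,
    show (z + 1 + 2) / 3 = z / 3 + 1 by ring, F_per (im_div3 hz)]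
  ring

lemma G_S {z : ℂ} (hz : 0 < z.im) : G (-1 / z) = z ^ 16 * G z := by
  have hz0 : z ≠ 0 := by rintro rfl; simp at hz
  have hSi := S_im hz
  have a : F (-1 / z) = 9 * (z / 3) ^ 4 * F (z / 3) := by
    rw [← F_fricke (im_div3 hz)]
    congr 1
    field_simp
  have b : F ((-1 / z) / 3) = 9 * z ^ 4 * F z := by
    rw [← F_fricke hz]
    congr 1
    field_simp
  have c : F ((-1 / z + 1) / 3) = z ^ 4 * F ((z + 2) / 3) := by
    have hy : 0 < ((z - 1) / 3).im := im_div3 (by simpa using hz)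
    have hx : 0 < ((-1 / z + 1) / 3).im := im_div3 (by simpa using hSi)
    rw [show (z + 2) / 3 = (z - 1) / 3 + 1 by ring, F_per hy]
    refine F_trans hx hy ?_ ?_
    · field_simp
      ring
    · rw [← F_per (S_im (im3 hx))]
      congr 1
      have h1 : z - 1 ≠ 0 := by
        intro h
        simp [h] at hy
      have h2 : 3 * ((-1 / z + 1) / 3) = (z - 1) / z := by field_simp; ring
      have h3 : 3 * ((z - 1) / 3) = z - 1 := by ring
      rw [h2, h3]
      field_simp
      ring
  have d : F ((-1 / z + 2) / 3) = z ^ 4 * F ((z + 1) / 3) := by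
    have hy : 0 < ((z + 1) / 3).im := im_div3 (by simpa using hz)
    have hx : 0 < ((-1 / z - 1) / 3).im := im_div3 (by simpa using hSi)
    rw [show (-1 / z + 2) / 3 = (-1 / z - 1) / 3 + 1 by ring, F_per hx]
    refine F_trans hx hy ?_ ?_
    · field_simp
      ring
    · rw [← F_per (S_im (im3 hy))]
      congr 1
      have h1 : z + 1 ≠ 0 := by
        intro h
        simp [h] at hy
      have h2 : 3 * ((-1 / z - 1) / 3) = - (z + 1) / z := by field_simp; ring
      have h3 : 3 * ((z + 1) / 3) = z + 1 := by ring
      have h4 : - (z + 1) ≠ 0 := neg_ne_zero.mpr h1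
      rw [h2, h3]
      field_simp
      ring
  simp only [G]
  rw [a, b, c, d]
  ring

lemma G_bound : ∃ C A : ℝ, ∀ z : ℂ, A ≤ z.im → 0 < z.im →
    ‖G z‖ ≤ C * Real.exp (-2 * Real.pi * z.im) ^ 2 := by
  obtain ⟨φ, h, h0⟩ := F_QE
  obtain ⟨C, A, hC, hb⟩ := h.bound h0
  refine ⟨C ^ 4, max A (3 * A), fun z hz hz' => ?_⟩
  have hA : A ≤ z.im := (le_max_left _ _).trans hz
  have hA3 : A ≤ z.im / 3 := by
    have := (le_max_right _ _).trans hz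
    linarith
  set e := Real.exp (-2 * Real.pi * (z.im / 3)) with he
  have h3 : Real.exp (-2 * Real.pi * z.im) = e ^ 3 := by
    rw [he, ← Real.exp_nat_mul]
    congr 1
    push_cast
    ring
  have key : ∀ c : ℂ, c.im = 0 → ‖F ((z + c) / 3)‖ ≤ C * e := by
    intro c hc
    have hi : ((z + c) / 3).im = z.im / 3 := by rw [im_div3_eq]; simp [hc]
    have := hb ((z + c) / 3) (by rw [hi]; exact hA3) (by rw [hi]; positivity)
    rwa [hi] at this
  have k0 := key 0 (by simp)
  have k1 := key 1 (by simp)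
  have k2 := key 2 (by simp)
  have k := hb z hA hz'
  rw [add_zero] at k0
  rw [h3] at k ⊢
  simp only [G, norm_mul]
  have he0 : 0 ≤ e := (Real.exp_pos _).le
  calc _ ≤ (C * e ^ 3) * ((C * e) * ((C * e) * (C * e))) := by gcongr
    _ = _ := by ring

lemma G_zero {z : ℂ} (hz : 0 < z.im) : G z = 0 :=
  lvl1 G 16 2 (by norm_num) (fun _ h => G_diff h) (fun _ h => G_per h) (fun _ h => G_S h)
    G_bound z hz

def HH : Set ℂ := {z | 0 < z.im}

lemma HH_open : IsOpen HH := isOpen_lt continuous_const continuous_im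

lemma HH_conn : IsPreconnected HH := (convex_halfSpace_im_gt 0).isPreconnected

lemma mul_zero_cases {f g : ℂ → ℂ} (hf : ∀ z, 0 < z.im → DifferentiableAt ℂ f z)
    (hg : ∀ z, 0 < z.im → DifferentiableAt ℂ g z)
    (h : ∀ z, 0 < z.im → f z * g z = 0) :
    (∀ z, 0 < z.im → f z = 0) ∨ (∀ z, 0 < z.im → g z = 0) := by
  have h1 : AnalyticOnNhd ℂ f HH :=
    DifferentiableOn.analyticOnNhd (fun z hz => (hf z hz).differentiableWithinAt) HH_open
  have h2 : AnalyticOnNhd ℂ g HH :=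
    DifferentiableOn.analyticOnNhd (fun z hz => (hg z hz).differentiableWithinAt) HH_open
  exact AnalyticOnNhd.eq_zero_or_eq_zero_of_mul_eq_zero h1 h2 h HH_conn

lemma F_zero_of (c : ℂ) (hc : c.im = 0) (h : ∀ z, 0 < z.im → F ((z + c) / 3) = 0) :
    ∀ z, 0 < z.im → F z = 0 := by
  intro z hz
  have := h (3 * z - c) (by simpa [hc] using hz)
  rwa [show (3 * z - c + c) / 3 = z by ring] at this

lemma F_zero : ∀ z : ℂ, 0 < z.im → F z = 0 := by
  have d0 := fun (z : ℂ) (hz : 0 < z.im) => F_diff3 0 (by simp) hz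
  have d1 := fun (z : ℂ) (hz : 0 < z.im) => F_diff3 1 (by simp) hz
  have d2 := fun (z : ℂ) (hz : 0 < z.im) => F_diff3 2 (by simp) hz
  have hG : ∀ z, 0 < z.im →
      F z * (F ((z + 0) / 3) * (F ((z + 1) / 3) * F ((z + 2) / 3))) = 0 := by
    intro z hz
    rw [add_zero]
    exact G_zero hz
  rcases mul_zero_cases (fun z hz => F_diff hz)
    (fun z hz => (d0 z hz).mul ((d1 z hz).mul (d2 z hz))) hG with h | h
  · exact h
  rcases mul_zero_cases d0 (fun z hz => (d1 z hz).mul (d2 z hz)) h with h | h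
  · exact F_zero_of 0 (by simp) h
  rcases mul_zero_cases d1 d2 h with h | h
  · exact F_zero_of 1 (by simp) h
  · exact F_zero_of 2 (by simp) h

end Ch

namespace Ch

open Filter Topology

def Ph (z : ℂ) : ℂ := (1 / 2) * (3 * R z + P z)
def X (z : ℂ) : ℂ := 9 * N z - M z

lemma hP {z : ℂ} (hz : 0 < z.im) : HasDerivAt P (kk * (P z * P z - M z) / 12) z := by
  refine (P_diff hz).hasDerivAt.congr_deriv ?_
  have := kk_ne
  rw [M]
  field_simp
  ring

lemma hM {z : ℂ} (hz : 0 < z.im) : HasDerivAt M (kk * (P z * M z - U z) / 3) z := by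
  refine (M_diff hz).hasDerivAt.congr_deriv ?_
  have := kk_ne
  rw [U]
  field_simp
  ring

lemma hU {z : ℂ} (hz : 0 < z.im) : HasDerivAt U (kk * (P z * U z - M z * M z) / 2) z := by
  refine (U_diff hz).hasDerivAt.congr_deriv ?_
  have := kk_ne
  have h := W_zero hz
  rw [W] at h
  field_simp at h ⊢
  linear_combination -h

lemma comp3 {f : ℂ → ℂ} {f' z : ℂ} (h : HasDerivAt f f' (3 * z)) :
    HasDerivAt (fun z => f (3 * z)) (f' * 3) z := by
  have h1 : HasDerivAt (fun z : ℂ => 3 * z) 3 z := by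
    simpa using (hasDerivAt_id z).const_mul 3
  exact h.comp z h1

lemma hR {z : ℂ} (hz : 0 < z.im) : HasDerivAt R (kk * (R z * R z - N z) / 4) z := by
  refine (comp3 (hP (im3 hz))).congr_deriv ?_
  simp only [R, N]; ring

lemma hN {z : ℂ} (hz : 0 < z.im) : HasDerivAt N (kk * (R z * N z - V z)) z := by
  refine (comp3 (hM (im3 hz))).congr_deriv ?_
  simp only [R, N, V]; ring

lemma hV {z : ℂ} (hz : 0 < z.im) : HasDerivAt V (3 * kk * (R z * V z - N z * N z) / 2) z := by
  refine (comp3 (hU (im3 hz))).congr_deriv ?_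
  simp only [R, N, V]; ring

lemma hPh {z : ℂ} (hz : 0 < z.im) :
    HasDerivAt Ph (kk * (Ph z ^ 2 - 4 * Sg z ^ 2) / 12 +
      kk / 24 * (10 * (Sg z * Sg z) - M z - 9 * N z)) z := by
  refine ((((hR hz).const_mul 3).add (hP hz)).const_mul (1 / 2)).congr_deriv ?_
  simp only [Ph, Sg]; ring

lemma hPh' {z : ℂ} (hz : 0 < z.im) :
    HasDerivAt Ph (kk * (Ph z ^ 2 - 4 * Sg z ^ 2) / 12) z := by
  refine (hPh hz).congr_deriv ?_
  have := F_zero z hz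
  rw [F] at this
  rw [this]; ring

lemma hSg {z : ℂ} (hz : 0 < z.im) :
    HasDerivAt Sg (kk * (4 * Sg z * Ph z - X z) / 24) z := by
  refine ((((hR hz).const_mul 3).sub (hP hz)).const_mul (1 / 2)).congr_deriv ?_
  simp only [Ph, Sg, X]; ring

lemma hX {z : ℂ} (hz : 0 < z.im) :
    HasDerivAt X (9 * (kk * (R z * N z - V z)) - kk * (P z * M z - U z) / 3) z :=
  ((hN hz).const_mul 9).sub (hM hz)

lemma deriv_zero_of {f : ℂ → ℂ} {f' z : ℂ} (hz : 0 < z.im) (h : HasDerivAt f f' z)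
    (h0 : ∀ z, 0 < z.im → f z = 0) : f' = 0 := by
  refine h.unique ((hasDerivAt_const z (0 : ℂ)).congr_of_eventuallyEq ?_)
  filter_upwards [im_pos_nhds hz] with w hw
  exact h0 w hw

lemma P_of (z : ℂ) : P z = Ph z - Sg z := by simp only [Ph, Sg]; ring
lemma R_of (z : ℂ) : R z = (Ph z + Sg z) / 3 := by simp only [Ph, Sg]; ring
lemma M_of {z : ℂ} (hz : 0 < z.im) : M z = 5 * Sg z ^ 2 - X z / 2 := by
  have := F_zero z hz
  simp only [F] at this
  simp only [X]
  linear_combination - this / 2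
lemma N_of {z : ℂ} (hz : 0 < z.im) : N z = (5 * Sg z ^ 2 + X z / 2) / 9 := by
  have := F_zero z hz
  simp only [F] at this
  simp only [X]
  linear_combination - this / 18

lemma I1 : ∀ z : ℂ, 0 < z.im → U z + 27 * V z - 7 / 2 * (Sg z * X z) = 0 := by
  intro z hz
  have h := deriv_zero_of hz
    ((((hSg hz).mul (hSg hz)).const_mul 10).sub (hM hz) |>.sub ((hN hz).const_mul 9)) F_zero
  rw [P_of, R_of, M_of hz, N_of hz] at h
  have hk := kk_ne
  apply mul_left_cancel₀ hk
  linear_combination 3 * h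

lemma I2 {z : ℂ} (hz : 0 < z.im) :
    Sg z * (U z - 27 * V z) = - 22 * Sg z ^ 4 - X z ^ 2 / 16 := by
  have h := deriv_zero_of hz
    (((hU hz).add ((hV hz).const_mul 27)).sub (((hSg hz).mul (hX hz)).const_mul (7 / 2))) I1
  have i1 := I1 z hz
  rw [P_of, R_of, M_of hz, N_of hz] at h
  have hk := kk_ne
  apply mul_left_cancel₀ hk
  linear_combination (-(3/5)) * h + (3 / 10 * kk * Ph z) * i1

end Ch

namespace Ch

open Filter Topology

lemma hX' {z : ℂ} (hz : 0 < z.im) (hS : Sg z ≠ 0) :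
    HasDerivAt X (kk * (Ph z * X z / 3 - 4 * Sg z ^ 3 - X z ^ 2 / (48 * Sg z))) z := by
  refine (hX hz).congr_deriv ?_
  have i2 := I2 hz
  rw [P_of, R_of, M_of hz, N_of hz]
  have e : X z ^ 2 / (48 * Sg z) = - (22 * Sg z ^ 3 + (U z - 27 * V z)) / 3 := by
    field_simp
    linear_combination 48 * i2
  rw [e]
  ring

def v (z : ℂ) : ℂ := kk / 12 * (Ph z + 2 * Sg z)

lemma hv {z : ℂ} (hz : 0 < z.im) :
    HasDerivAt v (kk ^ 2 / 144 * (Ph z ^ 2 - 4 * Sg z ^ 2 + 4 * Sg z * Ph z - X z)) z := by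
  refine (((hPh' hz).add ((hSg hz).const_mul 2)).const_mul (kk / 12)).congr_deriv ?_
  ring

lemma deriv_diff {f : ℂ → ℂ} (h : ∀ z, 0 < z.im → DifferentiableAt ℂ f z) :
    ∀ z, 0 < z.im → DifferentiableAt ℂ (deriv f) z := by
  intro z hz
  have h1 : DifferentiableOn ℂ f HH := fun z hz => (h z hz).differentiableWithinAt
  exact (h1.deriv HH_open).differentiableAt (HH_open.mem_nhds hz)

lemma v_d : ∀ z, 0 < z.im → DifferentiableAt ℂ v z := fun _ hz => (hv hz).differentiableAt

lemma u4_eq {z : ℂ} (hz : 0 < z.im) :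
    chazyU4 v z = - (kk ^ 2 / 144) * (X z + 8 * Sg z ^ 2) := by
  rw [chazyU4, (hv hz).deriv, v]
  ring

lemma u6_eq {z : ℂ} (hz : 0 < z.im) (hS : Sg z ≠ 0) :
    chazyU6 v z = kk ^ 3 / 144 *
      (28 / 3 * Sg z ^ 3 + 4 / 3 * (Sg z * X z) + X z ^ 2 / (48 * Sg z)) := by
  have h1 : HasDerivAt (chazyU4 v) (deriv (deriv v) z - 2 * v z * deriv v z) z := by
    refine ((deriv_diff v_d z hz).hasDerivAt.sub ((v_d z hz).hasDerivAt.pow 2)).congr_deriv ?_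
    simp
  have h2 := (((hX' hz hS).add (((hSg hz).pow 2).const_mul 8)).const_mul (-(kk ^ 2 / 144)))
  have h3 := h1.unique (h2.congr_of_eventuallyEq (by
    filter_upwards [im_pos_nhds hz] with w hw
    exact u4_eq hw))
  have h4 := u4_eq hz
  rw [chazyU4] at h4
  have : chazyU6 v z = (deriv (deriv v) z - 2 * v z * deriv v z) -
      4 * v z * (deriv v z - v z ^ 2) := by rw [chazyU6]; ring
  rw [this, h3, h4, v]
  simp only [Nat.cast_ofNat, Nat.add_one_sub_one, pow_one]
  field_simp
  ring

lemma u8_eq {z : ℂ} (hz : 0 < z.im) (hS : Sg z ≠ 0) :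
    chazyU8 v z = - (kk ^ 4 / 144) *
      (44 / 3 * Sg z ^ 4 + 8 / 3 * (Sg z ^ 2 * X z) + 5 / 48 * X z ^ 2) := by
  have d1 := deriv_diff v_d
  have d2 := deriv_diff d1
  have h1 : HasDerivAt (chazyU6 v) (deriv (deriv (deriv v)) z - 6 * (deriv v z * deriv v z
      + v z * deriv (deriv v) z) + 12 * v z ^ 2 * deriv v z) z := by
    have a := (v_d z hz).hasDerivAt
    have b := (d1 z hz).hasDerivAt
    have c := (d2 z hz).hasDerivAt
    refine ((c.sub ((a.const_mul 6).mul b)).add ((a.pow 3).const_mul 4)).congr_deriv ?_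
    simp
    ring
  have hs := hSg hz
  have hx := hX' hz hS
  have h2 := (((((hs.pow 3).const_mul (28 / 3)).add ((hs.mul hx).const_mul (4 / 3))).add
    ((hx.pow 2).div (hs.const_mul 48) (by simpa using hS))).const_mul (kk ^ 3 / 144))
  have h3 := h1.unique (h2.congr_of_eventuallyEq (by
    filter_upwards [im_pos_nhds hz, hs.continuousAt.eventually_ne hS] with w hw hw'
    exact u6_eq hw hw'))
  have h4 := u6_eq hz hS
  have : chazyU8 v z = (deriv (deriv (deriv v)) z - 6 * (deriv v z * deriv v z
      + v z * deriv (deriv v) z) + 12 * v z ^ 2 * deriv v z) -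
      6 * v z * chazyU6 v z := by rw [chazyU8, chazyU6]; ring
  rw [this, h3, h4, v]
  simp only [Nat.cast_ofNat, Nat.add_one_sub_one, pow_one, Pi.pow_apply, Pi.div_apply]
  field_simp
  ring

def ch (u : ℂ → ℂ) (τ : ℂ) : ℂ :=
  chazyU4 u τ * chazyU8 u τ ^ 2 - chazyU6 u τ ^ 2 * chazyU8 u τ +
    24 * chazyU4 u τ ^ 3 * chazyU8 u τ - 15 * chazyU4 u τ ^ 2 * chazyU6 u τ ^ 2 +
      144 * chazyU4 u τ ^ 5

lemma ch_zero : ∀ z : ℂ, 0 < z.im → ch v z = 0 := by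
  have hd : ∀ z, 0 < z.im → DifferentiableAt ℂ (ch v) z := by
    intro z hz
    have a := v_d z hz
    have b := deriv_diff v_d z hz
    have c := deriv_diff (deriv_diff v_d) z hz
    have d := deriv_diff (deriv_diff (deriv_diff v_d)) z hz
    unfold ch chazyU4 chazyU6 chazyU8
    fun_prop
  have h : ∀ z, 0 < z.im → Sg z * ch v z = 0 := by
    intro z hz
    by_cases hS : Sg z = 0
    · simp [hS]
    · rw [ch, u4_eq hz, u6_eq hz hS, u8_eq hz hS]
      field_simp
      ring
  rcases mul_zero_cases (fun z hz => (hSg hz).differentiableAt) hd h with h | h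
  · obtain ⟨φ, hφ, h0⟩ := Sg_QE
    obtain ⟨z, hz, hz'⟩ := hφ.tendsto (by simp [h0])
    exact absurd (h z hz) hz'
  · exact h

lemma eta_eq : dedekindEta = ModularForm.eta := by
  funext z
  simp only [dedekindEta, ModularForm.eta, ModularForm.eta_q, Function.Periodic.qParam, qq]
  congr 1
  · congr 1
    push_cast
    ring
  · simp

lemma hEta {z : ℂ} (hz : 0 < z.im) :
    HasDerivAt dedekindEta (kk / 24 * P z * dedekindEta z) z := by
  rw [eta_eq]
  have h1 := ModularForm.logDeriv_eta_eq_E2 ⟨z, hz⟩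
  have h2 : ModularForm.eta z ≠ 0 := ModularForm.eta_ne_zero hz
  have h3 := (ModularForm.differentiableAt_eta_of_mem_upperHalfPlaneSet hz).hasDerivAt
  refine h3.congr_deriv ?_
  rw [← P_eq, logDeriv_apply, div_eq_iff h2] at h1
  refine h1.trans ?_
  simp only [kk]
  ring

lemma eta_ne {z : ℂ} (hz : 0 < z.im) : dedekindEta z ≠ 0 := by
  rw [eta_eq]
  exact ModularForm.eta_ne_zero hz

lemma u_eq {z : ℂ} (hz : 0 < z.im) : 2 * (Real.pi : ℂ) * I / 3 * E3sig z = v z := by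
  have h1 := hEta hz
  have h2 := comp3 (hEta (im3 hz))
  have n1 := eta_ne hz
  have n2 := eta_ne (im3 hz)
  have h3 := ((((h2.pow 3).const_mul 3).div h1 n1).pow 3)
  have h4 : HasDerivAt (fun t => C3 t ^ 3) _ z := h3
  have hk := kk_ne
  have e : kk = 2 * Real.pi * I := rfl
  rw [E3sig, dq, h4.deriv, v, ← e]
  simp only [C3, Ph, Sg, R, Nat.cast_ofNat, Nat.add_one_sub_one, pow_one, Pi.pow_apply, Pi.div_apply]
  field_simp
  ring

lemma ch_congr {u w : ℂ → ℂ} {z : ℂ} (h : u =ᶠ[𝓝 z] w) : ch u z = ch w z := by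
  have h1 := h.deriv
  have h2 := h1.deriv
  have h3 := h2.deriv
  simp only [ch, chazyU4, chazyU6, chazyU8]
  rw [h.eq_of_nhds, h1.eq_of_nhds, h2.eq_of_nhds, h3.eq_of_nhds]

end Ch


theorem generalized_chazy_signature3 (τ : ℂ) (hτ : 0 < τ.im) :
    chazyU4 (fun t => 2 * (Real.pi : ℂ) * Complex.I / 3 * E3sig t) τ *
        chazyU8 (fun t => 2 * (Real.pi : ℂ) * Complex.I / 3 * E3sig t) τ ^ 2 -
      chazyU6 (fun t => 2 * (Real.pi : ℂ) * Complex.I / 3 * E3sig t) τ ^ 2 *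
        chazyU8 (fun t => 2 * (Real.pi : ℂ) * Complex.I / 3 * E3sig t) τ +
      24 * chazyU4 (fun t => 2 * (Real.pi : ℂ) * Complex.I / 3 * E3sig t) τ ^ 3 *
        chazyU8 (fun t => 2 * (Real.pi : ℂ) * Complex.I / 3 * E3sig t) τ -
      15 * chazyU4 (fun t => 2 * (Real.pi : ℂ) * Complex.I / 3 * E3sig t) τ ^ 2 *
        chazyU6 (fun t => 2 * (Real.pi : ℂ) * Complex.I / 3 * E3sig t) τ ^ 2 +
      144 * chazyU4 (fun t => 2 * (Real.pi : ℂ) * Complex.I / 3 * E3sig t) τ ^ 5 = 0 := by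
  have h : Ch.ch (fun t => 2 * (Real.pi : ℂ) * Complex.I / 3 * E3sig t) τ = Ch.ch Ch.v τ := by
    refine Ch.ch_congr ?_
    filter_upwards [Ch.im_pos_nhds hτ] with w hw
    exact Ch.u_eq hw
  exact h.trans (Ch.ch_zero τ hτ)
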